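/- arXiv:1410.4153 — 6 statements merged into one kernel-verified Lean document; each statement's English description precedes it below -/
import Mathlib

section
/- For every τ in the complex upper half-plane, θ[1/5,1/5](τ)^5 − θ[1/5,3/5](τ)^5 + θ[1/5,1](τ)^5 − θ[1/5,7/5](τ)^5 + θ[1/5,9/5](τ)^5 = 0. -/
open Complex

/-- The theta constant with characteristic `[ε; ε']`:
`θ[ε,ε'](τ) = ∑_{n ∈ ℤ} exp(2πi((1/2)(n+ε/2)²τ + (n+ε/2)(ε'/2)))`. -/
noncomputable def θ (ε ε' : ℝ) (τ : ℂ) : ℂ :=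
  ∑' n : ℤ, Complex.exp (2 * Real.pi * Complex.I *
    ((1 / 2) * ((n : ℂ) + (ε : ℂ) / 2) ^ 2 * τ + ((n : ℂ) + (ε : ℂ) / 2) * ((ε' : ℂ) / 2)))

/-- `ζ₅ = exp(2πi/5)`. -/
noncomputable def ζ₅ : ℂ := Complex.exp (2 * Real.pi * Complex.I / 5)

/-- The fifth power of an absolutely convergent sum, expanded as a sum over quintuples. -/
lemma hasSum_pow_five {ι : Type*} {f : ι → ℂ} (hf : Summable fun n => ‖f n‖) :
    HasSum (fun v : ι × ι × ι × ι × ι =>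
      f v.1 * (f v.2.1 * (f v.2.2.1 * (f v.2.2.2.1 * f v.2.2.2.2)))) ((∑' n, f n) ^ 5) := by
  have h2 := hf.mul_norm hf
  have h3 := hf.mul_norm h2
  have h4 := hf.mul_norm h3
  have h := (summable_mul_of_summable_norm hf h4).hasSum
  rwa [← tsum_mul_tsum_of_summable_norm hf h4, ← tsum_mul_tsum_of_summable_norm hf h3,
    ← tsum_mul_tsum_of_summable_norm hf h2, ← tsum_mul_tsum_of_summable_norm hf hf,
    show ∀ x : ℂ, x * (x * (x * (x * x))) = x ^ 5 by intro x; ring] at h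

/-- The series defining a theta constant converges absolutely on the upper half-plane. -/
lemma summable_norm_theta_term (ε ε' : ℝ) {τ : ℂ} (hτ : 0 < τ.im) :
    Summable fun n : ℤ => ‖Complex.exp (2 * Real.pi * Complex.I *
      ((1 / 2) * ((n : ℂ) + (ε : ℂ) / 2) ^ 2 * τ + ((n : ℂ) + (ε : ℂ) / 2) * ((ε' : ℂ) / 2)))‖ := by
  have h := (((summable_jacobiTheta₂_term_iff (ε * τ / 2 + ε' / 2) τ).2 hτ).mul_left
    (Complex.exp (2 * Real.pi * I * ((ε : ℂ) ^ 2 / 8 * τ + ε * ε' / 4)))).norm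
  refine h.congr fun n => ?_
  rw [jacobiTheta₂_term, ← Complex.exp_add]
  congr 2
  ring

/-- The sum of the entries of a quintuple of integers. -/
def quintupleSum (v : ℤ × ℤ × ℤ × ℤ × ℤ) : ℤ :=
  v.1 + v.2.1 + v.2.2.1 + v.2.2.2.1 + v.2.2.2.2

/-- Subtract the integer `c` from every entry of a quintuple. -/
def quintupleShift (c : ℤ) (v : ℤ × ℤ × ℤ × ℤ × ℤ) : ℤ × ℤ × ℤ × ℤ × ℤ :=
  (v.1 - c, v.2.1 - c, v.2.2.1 - c, v.2.2.2.1 - c, v.2.2.2.2 - c)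

/-- The Gaussian factor `exp(πiτ ∑ (nᵢ + 1/10)²)`. -/
noncomputable def quintupleGaussian (τ : ℂ) (v : ℤ × ℤ × ℤ × ℤ × ℤ) : ℂ :=
  Complex.exp (Real.pi * I * τ * (((v.1 : ℂ) + 1 / 10) ^ 2 + ((v.2.1 : ℂ) + 1 / 10) ^ 2 +
    ((v.2.2.1 : ℂ) + 1 / 10) ^ 2 + ((v.2.2.2.1 : ℂ) + 1 / 10) ^ 2 +
    ((v.2.2.2.2 : ℂ) + 1 / 10) ^ 2))

/-- The phase `exp(2πi(2N+1)/20)`, where `N` is the sum of the entries. -/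
noncomputable def quintuplePhase (v : ℤ × ℤ × ℤ × ℤ × ℤ) : ℂ :=
  Complex.exp (2 * Real.pi * I / 20) ^ (2 * quintupleSum v + 1)

lemma hasSum_theta_pow_five (k : ℕ) {τ : ℂ} (hτ : 0 < τ.im) :
    HasSum (fun v => quintupleGaussian τ v * quintuplePhase v ^ k) (θ (1 / 5) (k / 5) τ ^ 5) := by
  refine (hasSum_pow_five (summable_norm_theta_term (1 / 5) (k / 5) hτ)).congr_fun fun v => ?_
  rw [quintupleGaussian, quintuplePhase, quintupleSum, ← Complex.exp_int_mul,
    ← Complex.exp_nat_mul]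
  simp only [← Complex.exp_add]
  congr 1
  push_cast
  ring

/-- Reflection of the shifted lattice `(ℤ + 1/10)⁵` in the hyperplane of vectors of sum zero, on
those vectors where it preserves the lattice, and the identity elsewhere. -/
def quintupleReflect (v : ℤ × ℤ × ℤ × ℤ × ℤ) : ℤ × ℤ × ℤ × ℤ × ℤ :=
  if (5 : ℤ) ∣ quintupleSum v - 2 then
    quintupleShift (2 * ((quintupleSum v - 2) / 5) + 1) v else v

lemma quintupleSum_shift (c : ℤ) (v : ℤ × ℤ × ℤ × ℤ × ℤ) :
    quintupleSum (quintupleShift c v) = quintupleSum v - 5 * c := by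
  simp only [quintupleSum, quintupleShift]
  ring

lemma quintupleReflect_of_sum {v : ℤ × ℤ × ℤ × ℤ × ℤ} {m : ℤ} (h : quintupleSum v - 2 = 5 * m) :
    quintupleReflect v = quintupleShift (2 * m + 1) v := by
  rw [quintupleReflect, if_pos ⟨m, h⟩, h, Int.mul_ediv_cancel_left _ (by norm_num)]

lemma quintupleReflect_involutive : Function.Involutive quintupleReflect := by
  intro v
  by_cases h : (5 : ℤ) ∣ quintupleSum v - 2
  · obtain ⟨m, hm⟩ := h
    have h' : quintupleSum (quintupleShift (2 * m + 1) v) - 2 = 5 * (-m - 1) := by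
      rw [quintupleSum_shift]; linarith
    rw [quintupleReflect_of_sum hm, quintupleReflect_of_sum h']
    obtain ⟨a, b, c, d, e⟩ := v
    simp only [quintupleShift, Prod.mk.injEq]
    refine ⟨?_, ?_, ?_, ?_, ?_⟩ <;> ring
  · have h' : quintupleReflect v = v := if_neg h
    rw [h', h']

lemma quintupleGaussian_shift (τ : ℂ) {v : ℤ × ℤ × ℤ × ℤ × ℤ} {m : ℤ}
    (h : quintupleSum v - 2 = 5 * m) :
    quintupleGaussian τ (quintupleShift (2 * m + 1) v) = quintupleGaussian τ v := by
  obtain ⟨a, b, c, d, e⟩ := v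
  have ha : (a : ℂ) = 5 * m + 2 - b - c - d - e := by
    have : a = 5 * m + 2 - b - c - d - e := by simp only [quintupleSum] at h; linarith
    exact_mod_cast this
  simp only [quintupleGaussian, quintupleShift]
  congr 2
  push_cast
  rw [ha]
  ring

lemma exp_two_pi_I_div_twenty_pow_ten : Complex.exp (2 * Real.pi * I / 20) ^ 10 = -1 := by
  rw [← Complex.exp_nat_mul, ← Complex.exp_pi_mul_I]
  congr 1
  push_cast
  ring

lemma quintuplePhase_pow_ten (v : ℤ × ℤ × ℤ × ℤ × ℤ) : quintuplePhase v ^ 10 = -1 := by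
  rw [quintuplePhase, ← zpow_natCast, zpow_comm, zpow_natCast, exp_two_pi_I_div_twenty_pow_ten]
  exact Odd.neg_one_zpow ⟨_, rfl⟩

lemma quintuplePhase_sq_eq_neg_one_iff (v : ℤ × ℤ × ℤ × ℤ × ℤ) :
    quintuplePhase v ^ 2 = -1 ↔ (5 : ℤ) ∣ quintupleSum v - 2 := by
  have hp : IsPrimitiveRoot (Complex.exp (2 * Real.pi * I / 20)) 20 := by
    exact_mod_cast Complex.isPrimitiveRoot_exp 20 (by norm_num)
  have h0 := Complex.exp_ne_zero (2 * Real.pi * I / 20)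
  rw [quintuplePhase, ← zpow_natCast, ← zpow_mul, ← exp_two_pi_I_div_twenty_pow_ten,
    ← zpow_natCast _ 10, ← div_eq_one_iff_eq (zpow_ne_zero _ h0), ← zpow_sub₀ h0,
    hp.zpow_eq_one_iff_dvd]
  push_cast
  omega

lemma quintuplePhase_shift {v : ℤ × ℤ × ℤ × ℤ × ℤ} {m : ℤ} (h : quintupleSum v - 2 = 5 * m) :
    quintuplePhase (quintupleShift (2 * m + 1) v) = -quintuplePhase v := by
  have h2 := (quintuplePhase_sq_eq_neg_one_iff v).2 ⟨m, h⟩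
  have hinv : quintuplePhase (quintupleShift (2 * m + 1) v) = (quintuplePhase v)⁻¹ := by
    rw [quintuplePhase, quintuplePhase, quintupleSum_shift, ← zpow_neg]
    congr 1
    linarith
  rw [hinv]
  refine inv_eq_of_mul_eq_one_right ?_
  linear_combination -h2

theorem quintic_onefifth (τ : ℂ) (hτ : 0 < τ.im) :
    θ (1/5) (1/5) τ ^ 5 - θ (1/5) (3/5) τ ^ 5 + θ (1/5) 1 τ ^ 5 - θ (1/5) (7/5) τ ^ 5 + θ (1/5) (9/5) τ ^ 5 = 0 := by
  have h := ((((hasSum_theta_pow_five 1 hτ).sub (hasSum_theta_pow_five 3 hτ)).add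
    (hasSum_theta_pow_five 5 hτ)).sub (hasSum_theta_pow_five 7 hτ)).add
    (hasSum_theta_pow_five 9 hτ)
  norm_num at h
  have hneg := h.neg
  have hrefl := (quintupleReflect_involutive.toPerm.hasSum_iff).2 h
  refine self_eq_neg.1 (hrefl.unique (hneg.congr_fun fun v => ?_))
  simp only [Function.comp_apply, Function.Involutive.coe_toPerm]
  by_cases hv : (5 : ℤ) ∣ quintupleSum v - 2
  · obtain ⟨m, hm⟩ := hv
    rw [quintupleReflect_of_sum hm, quintupleGaussian_shift τ hm, quintuplePhase_shift hm]
    ring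
  · rw [show quintupleReflect v = v from if_neg hv]
    have hne : 1 + quintuplePhase v ^ 2 ≠ 0 := fun h0 =>
      hv ((quintuplePhase_sq_eq_neg_one_iff v).1 (by linear_combination h0))
    have h10 := quintuplePhase_pow_ten v
    have halt : quintuplePhase v - quintuplePhase v ^ 3 + quintuplePhase v ^ 5
        - quintuplePhase v ^ 7 + quintuplePhase v ^ 9 = 0 := by
      refine (mul_eq_zero.1 ?_).resolve_left hne
      linear_combination quintuplePhase v * h10
    linear_combination 2 * quintupleGaussian τ v * halt
end

section
/- For every τ in the complex upper half-plane, θ[3/5,1/5](τ)^5 − θ[3/5,3/5](τ)^5 + θ[3/5,1](τ)^5 − θ[3/5,7/5](τ)^5 + θ[3/5,9/5](τ)^5 = 0. -/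
open Complex

theorem θ_summable_norm (ε ε' : ℝ) (τ : ℂ) (hτ : 0 < τ.im) :
    Summable fun n : ℤ => ‖Complex.exp (2 * Real.pi * Complex.I *
      ((1 / 2) * ((n : ℂ) + (ε : ℂ) / 2) ^ 2 * τ + ((n : ℂ) + (ε : ℂ) / 2) * ((ε' : ℂ) / 2)))‖ := by
  have h := ((summable_jacobiTheta₂_term_iff ((ε : ℂ) / 2 * τ + (ε' : ℂ) / 2) τ).2 hτ).mul_left
    (Complex.exp (2 * Real.pi * Complex.I *
      ((1 / 2) * ((ε : ℂ) / 2) ^ 2 * τ + (ε : ℂ) / 2 * ((ε' : ℂ) / 2))))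
  refine Summable.norm (h.congr fun n => ?_)
  rw [jacobiTheta₂_term, ← Complex.exp_add]
  congr 1
  ring

theorem hasSum_pow_five_s1 {ι R : Type*} [NormedCommRing R] [CompleteSpace R] {f : ι → R}
    (hf : Summable fun i => ‖f i‖) :
    HasSum (fun p : ι × ι × ι × ι × ι =>
      f p.1 * (f p.2.1 * (f p.2.2.1 * (f p.2.2.2.1 * f p.2.2.2.2)))) ((∑' i, f i) ^ 5) := by
  have h2 := hf.mul_norm hf
  have h3 := hf.mul_norm h2
  have h4 := hf.mul_norm h3
  have h5 := hf.mul_norm h4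
  have h : (∑' i, f i) ^ 5 = ∑' p : ι × ι × ι × ι × ι,
      f p.1 * (f p.2.1 * (f p.2.2.1 * (f p.2.2.2.1 * f p.2.2.2.2))) := by
    rw [← tsum_mul_tsum_of_summable_norm hf h4, ← tsum_mul_tsum_of_summable_norm hf h3,
      ← tsum_mul_tsum_of_summable_norm hf h2, ← tsum_mul_tsum_of_summable_norm hf hf]
    ring
  rw [h]
  exact h5.of_norm.hasSum

/-- The sum of the coordinates of an integer quintuple. -/
def quintSum (p : ℤ × ℤ × ℤ × ℤ × ℤ) : ℤ := p.1 + p.2.1 + p.2.2.1 + p.2.2.2.1 + p.2.2.2.2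

/-- On the quintuples `p` with `quintSum p = 5 * m + 1`, the reflection of `p + 3/10` in the
hyperplane of coordinate sum zero, that is, subtraction of `2 * m + 1` from each coordinate;
the identity elsewhere. -/
def quintReflect (p : ℤ × ℤ × ℤ × ℤ × ℤ) : ℤ × ℤ × ℤ × ℤ × ℤ :=
  if 5 ∣ quintSum p - 1 then
    let c := 2 * ((quintSum p - 1) / 5) + 1
    (p.1 - c, p.2.1 - c, p.2.2.1 - c, p.2.2.2.1 - c, p.2.2.2.2 - c)
  else p

theorem quintReflect_of_quintSum_eq {a b c d e m : ℤ} (h : quintSum (a, b, c, d, e) = 5 * m + 1) :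
    quintReflect (a, b, c, d, e) = (a - (2 * m + 1), b - (2 * m + 1), c - (2 * m + 1),
      d - (2 * m + 1), e - (2 * m + 1)) := by
  have h5 : (5 * m + 1 - 1) / 5 = m := by omega
  simp [quintReflect, h]

theorem quintReflect_of_not_dvd {p : ℤ × ℤ × ℤ × ℤ × ℤ} (h : ¬ 5 ∣ quintSum p - 1) :
    quintReflect p = p := if_neg h

theorem quintReflect_involutive : Function.Involutive quintReflect := by
  rintro ⟨a, b, c, d, e⟩
  by_cases h : 5 ∣ quintSum (a, b, c, d, e) - 1
  · obtain ⟨m, hm⟩ := h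
    have h1 : quintSum (a, b, c, d, e) = 5 * m + 1 := by omega
    rw [quintReflect_of_quintSum_eq h1, quintReflect_of_quintSum_eq (m := -m - 1)]
    · simp only [Prod.mk.injEq]
      refine ⟨?_, ?_, ?_, ?_, ?_⟩ <;> ring
    · simp only [quintSum] at h1 ⊢
      linarith
  · rw [quintReflect_of_not_dvd h, quintReflect_of_not_dvd h]

theorem alternating_odd_powers_eq_zero {N : ℤ} (hN : ¬ 5 ∣ N - 1) {w : ℂ}
    (hw : w = Complex.exp (Real.pi * Complex.I * (2 * N + 3) / 10)) :
    w - w ^ 3 + w ^ 5 - w ^ 7 + w ^ 9 = 0 := by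
  have h10 : w ^ 10 = -1 := by
    rw [hw, ← Complex.exp_nat_mul,
      show ((10 : ℕ) : ℂ) * (Real.pi * Complex.I * (2 * N + 3) / 10) =
        Real.pi * Complex.I + (N + 1 : ℤ) * (2 * Real.pi * Complex.I) by push_cast; ring,
      Complex.exp_add, Complex.exp_int_mul_two_pi_mul_I, Complex.exp_pi_mul_I, mul_one]
  have h2 : 1 + w ^ 2 ≠ 0 := by
    intro h
    apply hN
    have h1 : Complex.exp (2 * (Real.pi * Complex.I * (2 * N + 3) / 10) - Real.pi * Complex.I)
        = 1 := by
      rw [Complex.exp_sub, Complex.exp_pi_mul_I,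
        show (2 : ℂ) = ((2 : ℕ) : ℂ) by norm_num, Complex.exp_nat_mul]
      push_cast
      rw [← hw]
      linear_combination -h
    obtain ⟨n, hn⟩ := Complex.exp_eq_one_iff.1 h1
    have hpi : (Real.pi : ℂ) * Complex.I ≠ 0 :=
      mul_ne_zero (by exact_mod_cast Real.pi_ne_zero) Complex.I_ne_zero
    have h3 : ((N - 1 : ℤ) : ℂ) = ((5 * n : ℤ) : ℂ) := by
      apply mul_left_cancel₀ hpi
      push_cast
      linear_combination 5 / 2 * hn
    exact ⟨n, by exact_mod_cast h3⟩
  apply (mul_eq_zero.1 (_ : (1 + w ^ 2) * _ = 0)).resolve_left h2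
  linear_combination w * h10

theorem θ_term_prod (k : ℕ) (ε' : ℝ) (hε : ε' = (2 * k + 1) / 5) (τ : ℂ) (a b c d e : ℤ)
    {f : ℤ → ℂ} (hf : f = fun n : ℤ => Complex.exp (2 * Real.pi * Complex.I *
      ((1 / 2) * ((n : ℂ) + ((3 / 5 : ℝ) : ℂ) / 2) ^ 2 * τ +
        ((n : ℂ) + ((3 / 5 : ℝ) : ℂ) / 2) * ((ε' : ℂ) / 2)))) :
    f a * (f b * (f c * (f d * f e))) =
      Complex.exp (Real.pi * Complex.I * τ * ((a + 3 / 10) ^ 2 + (b + 3 / 10) ^ 2 +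
        (c + 3 / 10) ^ 2 + (d + 3 / 10) ^ 2 + (e + 3 / 10) ^ 2)) *
      Complex.exp (Real.pi * Complex.I * (2 * quintSum (a, b, c, d, e) + 3) / 10) ^ (2 * k + 1) := by
  subst hf hε
  simp only [← Complex.exp_nat_mul, ← Complex.exp_add, quintSum]
  congr 1
  push_cast
  ring

theorem quintic_threefifths (τ : ℂ) (hτ : 0 < τ.im) :
    θ (3/5) (1/5) τ ^ 5 - θ (3/5) (3/5) τ ^ 5 + θ (3/5) 1 τ ^ 5 - θ (3/5) (7/5) τ ^ 5 + θ (3/5) (9/5) τ ^ 5 = 0 := by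
  have hS := ((((hasSum_pow_five_s1 (θ_summable_norm (3/5) (1/5) τ hτ)).sub
    (hasSum_pow_five_s1 (θ_summable_norm (3/5) (3/5) τ hτ))).add
    (hasSum_pow_five_s1 (θ_summable_norm (3/5) 1 τ hτ))).sub
    (hasSum_pow_five_s1 (θ_summable_norm (3/5) (7/5) τ hτ))).add
    (hasSum_pow_five_s1 (θ_summable_norm (3/5) (9/5) τ hτ))
  set G : ℤ × ℤ × ℤ × ℤ × ℤ → ℂ := fun p =>
    Complex.exp (Real.pi * Complex.I * τ * ((p.1 + 3 / 10) ^ 2 + (p.2.1 + 3 / 10) ^ 2 +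
      (p.2.2.1 + 3 / 10) ^ 2 + (p.2.2.2.1 + 3 / 10) ^ 2 + (p.2.2.2.2 + 3 / 10) ^ 2)) *
    (fun w : ℂ => w - w ^ 3 + w ^ 5 - w ^ 7 + w ^ 9)
      (Complex.exp (Real.pi * Complex.I * (2 * quintSum p + 3) / 10)) with hG
  have hSG : HasSum G (θ (3/5) (1/5) τ ^ 5 - θ (3/5) (3/5) τ ^ 5 + θ (3/5) 1 τ ^ 5
      - θ (3/5) (7/5) τ ^ 5 + θ (3/5) (9/5) τ ^ 5) := by
    refine (funext ?_ : _ = G) ▸ hS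
    rintro ⟨a, b, c, d, e⟩
    have h0 := θ_term_prod 0 (1/5) (by norm_num) τ a b c d e rfl
    have h1 := θ_term_prod 1 (3/5) (by norm_num) τ a b c d e rfl
    have h2 := θ_term_prod 2 1 (by norm_num) τ a b c d e rfl
    have h3 := θ_term_prod 3 (7/5) (by norm_num) τ a b c d e rfl
    have h4 := θ_term_prod 4 (9/5) (by norm_num) τ a b c d e rfl
    simp only [hG]
    rw [h0, h1, h2, h3, h4]
    ring
  have hodd : ∀ p, G (quintReflect p) = -G p := by
    rintro ⟨a, b, c, d, e⟩
    by_cases h : 5 ∣ quintSum (a, b, c, d, e) - 1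
    · obtain ⟨m, hm⟩ := h
      have hN : quintSum (a, b, c, d, e) = 5 * m + 1 := by omega
      have hN' : quintSum (quintReflect (a, b, c, d, e)) = 5 * (-m - 1) + 1 := by
        rw [quintReflect_of_quintSum_eq hN]
        simp only [quintSum] at hN ⊢
        linarith
      have hw : Complex.exp (Real.pi * Complex.I * (2 * (5 * (-m - 1) + 1 : ℤ) + 3) / 10) =
          -Complex.exp (Real.pi * Complex.I * (2 * (5 * m + 1 : ℤ) + 3) / 10) := by
        rw [← mul_neg_one (Complex.exp _), ← Complex.exp_pi_mul_I, ← Complex.exp_add,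
          Complex.exp_eq_exp_iff_exists_int]
        exact ⟨-m - 1, by push_cast; ring⟩
      simp only [hG, hN', hN, hw]
      rw [quintReflect_of_quintSum_eq hN, ← mul_neg]
      congr 1
      · congr 2
        have hC : (a : ℂ) + b + c + d + e = 5 * m + 1 := by exact_mod_cast hN
        push_cast
        linear_combination -2 * (2 * (m : ℂ) + 1) * hC
      · ring
    · rw [quintReflect_of_not_dvd h]
      simp only [hG, alternating_odd_powers_eq_zero h rfl, mul_zero, neg_zero]
  have h1 := (quintReflect_involutive.toPerm.hasSum_iff).2 hSG
  have h2 : G ∘ quintReflect_involutive.toPerm = fun p => -G p := funext hodd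
  rw [h2] at h1
  exact self_eq_neg.1 (h1.unique hSG.neg)
end

section
/- For every τ in the complex upper half-plane, ζ₅·θ[1/5,1/5](τ)^5 + ζ₅³·θ[3/5,1/5](τ)^5 + θ[1,1/5](τ)^5 − ζ₅²·θ[3/5,9/5](τ)^5 − ζ₅⁴·θ[1/5,9/5](τ)^5 = 0. -/
open Complex

/-- The Gaussian summand at the half-integral point `(2y+1)/10` of the theta series with
`ε' = 1/5`. -/
noncomputable def thetaSummand (τ : ℂ) (y : ℤ) : ℂ :=
  cexp (Real.pi * I * (τ * ((2 * y + 1) / 10) ^ 2 + (2 * y + 1) / 50))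

/-- The sum of `thetaSummand` over the residue class of `y` modulo `5`. -/
noncomputable def thetaClass (τ : ℂ) (y : ℤ) : ℂ :=
  ∑' m : ℤ, thetaSummand τ (y + 5 * m)

/-- The fifth root of unity `ζ₅ ^ (2y+1)`. -/
noncomputable def oddPhase (y : ℤ) : ℂ :=
  cexp (2 * Real.pi * I * ((2 * y + 1) / 5))

/-- The terms of the expansion of the weighted sum of fifth powers. -/
noncomputable def quinticTerm (τ : ℂ) (p : ℤ × ((ℤ × ℤ) × (ℤ × ℤ))) : ℂ :=
  oddPhase p.1 * (thetaSummand τ p.1 *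
    ((thetaSummand τ (p.1 + 5 * p.2.1.1) * thetaSummand τ (p.1 + 5 * p.2.1.2)) *
      (thetaSummand τ (p.1 + 5 * p.2.2.1) * thetaSummand τ (p.1 + 5 * p.2.2.2))))

lemma summable_norm_thetaSummand {τ : ℂ} (hτ : 0 < τ.im) :
    Summable fun y => ‖thetaSummand τ y‖ := by
  have h : Summable fun n : ℤ => jacobiTheta₂_term n ((τ + 1) / 50) (τ / 25) := by
    rw [summable_jacobiTheta₂_term_iff]
    have : (τ / 25).im = τ.im / 25 := Complex.div_ofNat_im τ 25
    rw [this]; positivity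
  refine ((h.mul_left (cexp (Real.pi * I * (τ / 100 + 1 / 50)))).congr fun y => ?_).norm
  rw [thetaSummand, jacobiTheta₂_term, ← Complex.exp_add]
  congr 1
  ring

lemma summable_norm_thetaSummand_shift {τ : ℂ} (hτ : 0 < τ.im) (y : ℤ) :
    Summable fun m : ℤ => ‖thetaSummand τ (y + 5 * m)‖ :=
  (summable_norm_thetaSummand hτ).comp_injective fun a b (h : y + 5 * a = y + 5 * b) => by
    omega

lemma norm_oddPhase (y : ℤ) : ‖oddPhase y‖ = 1 := by
  have : 2 * (Real.pi : ℂ) * I * ((2 * y + 1) / 5)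
      = ((2 * Real.pi * ((2 * y + 1) / 5) : ℝ) : ℂ) * I := by
    push_cast; ring
  rw [oddPhase, this, Complex.norm_exp_ofReal_mul_I]

lemma oddPhase_add_five_mul (y m : ℤ) : oddPhase (y + 5 * m) = oddPhase y := by
  rw [oddPhase, oddPhase, Complex.exp_eq_exp_iff_exists_int]
  exact ⟨2 * m, by push_cast; ring⟩

lemma thetaClass_add_five_mul (τ : ℂ) (y m : ℤ) :
    thetaClass τ (y + 5 * m) = thetaClass τ y := by
  rw [thetaClass, thetaClass, ← (Equiv.addLeft m).tsum_eq fun k => thetaSummand τ (y + 5 * k)]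
  refine tsum_congr fun k => ?_
  simp only [Equiv.coe_addLeft]
  congr 1
  ring

lemma summable_quinticTerm {τ : ℂ} (hτ : 0 < τ.im) : Summable (quinticTerm τ) := by
  have h := summable_norm_thetaSummand hτ
  have h2 := h.mul_norm h
  have h5 := h.mul_norm (h2.mul_norm h2)
  refine Summable.of_norm ?_
  let e : ℤ × ((ℤ × ℤ) × (ℤ × ℤ)) → ℤ × ((ℤ × ℤ) × (ℤ × ℤ)) := fun p =>
    (p.1, (p.1 + 5 * p.2.1.1, p.1 + 5 * p.2.1.2), (p.1 + 5 * p.2.2.1, p.1 + 5 * p.2.2.2))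
  have he : Function.Injective e := by
    rintro ⟨y, ⟨a, b⟩, c, d⟩ ⟨y', ⟨a', b'⟩, c', d'⟩ hp
    simp only [e, Prod.mk.injEq] at hp ⊢
    omega
  refine (h5.comp_injective he).congr fun p => ?_
  simp only [e, Function.comp_apply, quinticTerm, norm_mul, norm_oddPhase, one_mul]

/-- The reflection in the hyperplane orthogonal to `(1,1,1,1,1)`, in lattice coordinates. -/
def latticeReflection : ℤ × ((ℤ × ℤ) × (ℤ × ℤ)) ≃ ℤ × ((ℤ × ℤ) × (ℤ × ℤ)) :=
  Function.Involutive.toPerm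
    (fun p => (-p.1 - 1 - 2 * (p.2.1.1 + p.2.1.2 + p.2.2.1 + p.2.2.2), p.2))
    (fun p => Prod.ext (by simp only; ring) rfl)

lemma latticeReflection_apply (p : ℤ × ((ℤ × ℤ) × (ℤ × ℤ))) :
    latticeReflection p = (-p.1 - 1 - 2 * (p.2.1.1 + p.2.1.2 + p.2.2.1 + p.2.2.2), p.2) :=
  rfl

lemma quinticTerm_latticeReflection (τ : ℂ) (p : ℤ × ((ℤ × ℤ) × (ℤ × ℤ))) :
    quinticTerm τ (latticeReflection p) = -quinticTerm τ p := by
  obtain ⟨y, ⟨a, b⟩, c, d⟩ := p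
  have hneg : ∀ z : ℂ, -cexp z = cexp (z + Real.pi * I) := fun z => by
    rw [Complex.exp_add, Complex.exp_pi_mul_I, mul_neg_one]
  simp only [latticeReflection_apply, quinticTerm, oddPhase, thetaSummand,
    ← Complex.exp_add]
  rw [hneg, Complex.exp_eq_exp_iff_exists_int]
  refine ⟨-(y + a + b + c + d) - 1, ?_⟩
  push_cast
  ring

lemma tsum_quinticTerm (τ : ℂ) : ∑' p, quinticTerm τ p = 0 := by
  have h := latticeReflection.tsum_eq (quinticTerm τ)
  simp only [quinticTerm_latticeReflection, tsum_neg] at h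
  exact self_eq_neg.mp h.symm

lemma tsum_quinticTerm_fiber {τ : ℂ} (hτ : 0 < τ.im) (y : ℤ) :
    ∑' m, quinticTerm τ (y, m) = oddPhase y * (thetaSummand τ y * thetaClass τ y ^ 4) := by
  have h := summable_norm_thetaSummand_shift hτ y
  have h2 := h.mul_norm h
  simp only [quinticTerm, tsum_mul_left]
  rw [← tsum_mul_tsum_of_summable_norm h2 h2, ← tsum_mul_tsum_of_summable_norm h h, thetaClass]
  ring

lemma sum_oddPhase_mul_thetaClass_pow {τ : ℂ} (hτ : 0 < τ.im) :
    ∑ b : Fin 5, oddPhase (b : ℕ) * thetaClass τ (b : ℕ) ^ 5 = 0 := by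
  have hs := summable_quinticTerm hτ
  have hs1 : Summable fun y => oddPhase y * (thetaSummand τ y * thetaClass τ y ^ 4) := by
    simpa only [tsum_quinticTerm_fiber hτ] using hs.prod
  have h0 : ∑' y, oddPhase y * (thetaSummand τ y * thetaClass τ y ^ 4) = 0 := by
    rw [← tsum_quinticTerm τ, hs.tsum_prod]
    exact tsum_congr fun y => (tsum_quinticTerm_fiber hτ y).symm
  let e : Fin 5 × ℤ ≃ ℤ := (Equiv.prodComm _ _).trans (Int.divModEquiv 5).symm
  have he : ∀ b n, e (b, n) = (b : ℕ) + 5 * n := fun b n => by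
    simp [e, Int.divModEquiv, mul_comm, add_comm]
  have hs2 := e.summable_iff.mpr hs1
  simp only [Function.comp_def] at hs2
  rw [← e.tsum_eq, hs2.tsum_prod, tsum_fintype] at h0
  rw [← h0]
  refine Finset.sum_congr rfl fun b _ => ?_
  simp only [he, oddPhase_add_five_mul, thetaClass_add_five_mul, tsum_mul_left, tsum_mul_right]
  rw [← thetaClass]
  ring

lemma θ_eq_thetaClass (τ : ℂ) (y : ℤ) : θ ((2 * y + 1) / 5) (1 / 5) τ = thetaClass τ y := by
  refine tsum_congr fun n => ?_
  rw [thetaSummand]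
  congr 1
  push_cast
  ring

lemma θ_nine_fifths_pow (τ : ℂ) (y : ℤ) :
    θ ((2 * y + 1) / 5) (9 / 5) τ ^ 5 = -thetaClass τ (4 - y) ^ 5 := by
  have h : θ ((2 * y + 1) / 5) (9 / 5) τ
      = cexp (-(Real.pi * I * (9 - 2 * y) / 5)) * thetaClass τ (4 - y) := by
    rw [θ, thetaClass, ← tsum_mul_left, ← (Equiv.subLeft (-1 : ℤ)).tsum_eq]
    refine tsum_congr fun n => ?_
    rw [thetaSummand, ← Complex.exp_add, Complex.exp_eq_exp_iff_exists_int]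
    refine ⟨-n, ?_⟩
    simp only [Equiv.subLeft_apply]
    push_cast
    ring
  have hm : cexp (-(Real.pi * I * (9 - 2 * y) / 5)) ^ 5 = -1 := by
    rw [← Complex.exp_nat_mul, ← Complex.exp_pi_mul_I, Complex.exp_eq_exp_iff_exists_int]
    refine ⟨y - 5, ?_⟩
    push_cast
    ring
  rw [h, mul_pow, hm, neg_one_mul]

lemma oddPhase_natCast (b k j : ℕ) (h : 2 * b + 1 = k + 5 * j) : oddPhase b = ζ₅ ^ k := by
  rw [oddPhase, ζ₅, ← Complex.exp_nat_mul, Complex.exp_eq_exp_iff_exists_int]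
  refine ⟨j, ?_⟩
  have h' : 2 * (b : ℂ) + 1 = k + 5 * j := by exact_mod_cast h
  push_cast
  rw [h']
  ring

theorem quintic_second_onefifth (τ : ℂ) (hτ : 0 < τ.im) :
    ζ₅ * θ (1/5) (1/5) τ ^ 5 + ζ₅ ^ 3 * θ (3/5) (1/5) τ ^ 5 + θ 1 (1/5) τ ^ 5 - ζ₅ ^ 2 * θ (3/5) (9/5) τ ^ 5 - ζ₅ ^ 4 * θ (1/5) (9/5) τ ^ 5 = 0 := by
  have h := sum_oddPhase_mul_thetaClass_pow hτ
  have h0 := θ_eq_thetaClass τ 0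
  have h1 := θ_eq_thetaClass τ 1
  have h2 := θ_eq_thetaClass τ 2
  have h3 := θ_nine_fifths_pow τ 1
  have h4 := θ_nine_fifths_pow τ 0
  rw [Fin.sum_univ_five, oddPhase_natCast _ 1 0 rfl, oddPhase_natCast _ 3 0 rfl,
    oddPhase_natCast _ 0 1 rfl, oddPhase_natCast _ 2 1 rfl, oddPhase_natCast _ 4 1 rfl] at h
  norm_num at h h0 h1 h2 h3 h4
  rw [h0, h1, h2, h3, h4]
  linear_combination h
end

section
/- For every τ in the complex upper half-plane, θ[1,1/5](τ)·( ζ₅²·θ[1/5,7/5](τ)²·θ[1/5,1/5](τ) − ζ₅²·θ[1/5,3/5](τ)²·θ[1/5,9/5](τ) ) = θ[1,3/5](τ)·( θ[1/5,1/5](τ)²·θ[1/5,3/5](τ) − ζ₅⁴·θ[1/5,9/5](τ)²·θ[1/5,7/5](τ) ). -/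
open Complex

/-- The general term of the series `oddTheta`. -/
noncomputable def oddThetaTerm (n : ℤ) (x τ : ℂ) : ℂ :=
  exp (Real.pi * I * (n + 1 / 2) ^ 2 * τ + 2 * Real.pi * I * (n + 1 / 2) * (x + 1 / 2))

/-- The odd Jacobi theta function, up to sign. -/
noncomputable def oddTheta (x τ : ℂ) : ℂ := ∑' n : ℤ, oddThetaTerm n x τ

lemma exp_two_pi_mul_I_mul_int (n : ℤ) : exp (2 * Real.pi * I * n) = 1 := by
  rw [mul_comm]
  exact exp_int_mul_two_pi_mul_I n

lemma exp_two_pi_mul_I_mul_int_add_half (n : ℤ) :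
    exp (2 * Real.pi * I * (n + 1 / 2)) = -1 := by
  have h : 2 * Real.pi * I * (n + 1 / 2) = 2 * Real.pi * I * n + Real.pi * I := by ring
  rw [h, exp_add, exp_two_pi_mul_I_mul_int, exp_pi_mul_I, one_mul]

lemma summable_oddThetaTerm (x : ℂ) {τ : ℂ} (hτ : 0 < τ.im) :
    Summable fun n : ℤ ↦ oddThetaTerm n x τ := by
  refine (summable_congr fun n ↦ ?_).mpr
    (((hasSum_jacobiTheta₂_term (x + 1 / 2 + τ / 2) hτ).summable).mul_left
      (exp (Real.pi * I * τ / 4 + Real.pi * I * (x + 1 / 2))))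
  rw [oddThetaTerm, jacobiTheta₂_term, ← exp_add]
  congr 1
  ring

lemma oddTheta_neg (x τ : ℂ) : oddTheta (-x) τ = -oddTheta x τ := by
  rw [oddTheta, oddTheta, ← tsum_neg, ← (Equiv.subLeft (-1 : ℤ)).tsum_eq]
  refine tsum_congr fun n ↦ ?_
  rw [← mul_neg_one (oddThetaTerm n x τ), Equiv.subLeft_apply,
    ← exp_two_pi_mul_I_mul_int_add_half (-1 - n), oddThetaTerm, oddThetaTerm, ← exp_add]
  push_cast
  congr 1
  ring

lemma oddTheta_add_one (x τ : ℂ) : oddTheta (x + 1) τ = -oddTheta x τ := by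
  rw [oddTheta, oddTheta, ← tsum_neg]
  refine tsum_congr fun n ↦ ?_
  rw [← mul_neg_one, ← exp_two_pi_mul_I_mul_int_add_half n, oddThetaTerm, oddThetaTerm, ← exp_add]
  congr 1
  ring

/-- Change of variables splitting pairs of integers according to the parity of their difference. -/
def intProdParityEquiv : (ℤ × ℤ) ⊕ (ℤ × ℤ) ≃ ℤ × ℤ where
  toFun := Sum.elim (fun p ↦ (p.1 + p.2, p.1 - p.2 - 1)) (fun p ↦ (p.1 + p.2, p.1 - p.2))
  invFun p :=
    if (p.1 - p.2) % 2 = 1 then Sum.inl ((p.1 + p.2 + 1) / 2, (p.1 - p.2) / 2)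
    else Sum.inr ((p.1 + p.2) / 2, (p.1 - p.2) / 2)
  left_inv := by
    rintro (⟨k, l⟩ | ⟨k, l⟩)
    · have h : (k + l - (k - l - 1)) % 2 = 1 := by omega
      simp only [Sum.elim_inl, h, if_true, Sum.inl.injEq, Prod.mk.injEq]
      omega
    · have h : ¬ (k + l - (k - l)) % 2 = 1 := by omega
      simp only [Sum.elim_inr, h, if_false, Sum.inr.injEq, Prod.mk.injEq]
      omega
  right_inv := by
    rintro ⟨m, n⟩
    by_cases h : (m - n) % 2 = 1
    · simp only [h, if_true, Sum.elim_inl, Prod.mk.injEq]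
      omega
    · simp only [h, if_false, Sum.elim_inr, Prod.mk.injEq]
      omega

/-- The addition formula for the odd theta function. -/
lemma exists_oddTheta_add_mul_sub {τ : ℂ} (hτ : 0 < τ.im) :
    ∃ A B : ℂ → ℂ, ∀ x y,
      oddTheta (x + y) τ * oddTheta (x - y) τ = A x * B y - B x * A y := by
  let a : ℂ → ℤ → ℂ := fun x k ↦ jacobiTheta₂_term k (2 * x) (2 * τ)
  let b : ℂ → ℤ → ℂ := fun x k ↦
    exp (2 * Real.pi * I * x + Real.pi * I * τ / 2) * jacobiTheta₂_term k (2 * x + τ) (2 * τ)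
  have h2 : 0 < (2 * τ).im := by simpa using hτ
  have ha (x) : Summable (a x) := (hasSum_jacobiTheta₂_term _ h2).summable
  have hb (x) : Summable (b x) := ((hasSum_jacobiTheta₂_term _ h2).summable).mul_left _
  refine ⟨fun x ↦ ∑' k, a x k, fun x ↦ ∑' k, b x k, fun x y ↦ ?_⟩
  have hmul {f g : ℤ → ℂ} (hf : Summable f) (hg : Summable g) :
      HasSum (fun p : ℤ × ℤ ↦ f p.1 * g p.2) ((∑' k, f k) * ∑' k, g k) :=
    hf.hasSum.mul hg.hasSum (summable_mul_of_summable_norm hf.norm hg.norm)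
  have hl := hmul (summable_oddThetaTerm (x + y) hτ) (summable_oddThetaTerm (x - y) hτ)
  rw [← intProdParityEquiv.hasSum_iff] at hl
  refine (hl.unique (HasSum.sum (a := (∑' k, a x k) * ∑' k, b y k)
    (b := -((∑' k, b x k) * ∑' k, a y k)) ?_ ?_)).trans (sub_eq_add_neg _ _).symm
  · convert! hmul (ha x) (hb y) using 2 with p
    obtain ⟨k, l⟩ := p
    simp only [Function.comp_apply, intProdParityEquiv, Equiv.coe_fn_mk, Sum.elim_inl, a, b,
      oddThetaTerm, jacobiTheta₂_term]
    conv_rhs =>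
      rw [← mul_one (exp _ * _)]
      arg 2
      rw [← exp_two_pi_mul_I_mul_int k]
    simp only [← exp_add]
    push_cast
    congr 1
    ring
  · convert! (hmul (hb x) (ha y)).neg using 2 with p
    obtain ⟨k, l⟩ := p
    simp only [Function.comp_apply, intProdParityEquiv, Equiv.coe_fn_mk, Sum.elim_inr, a, b,
      oddThetaTerm, jacobiTheta₂_term]
    rw [← mul_neg_one, ← exp_two_pi_mul_I_mul_int_add_half k]
    simp only [← exp_add]
    push_cast
    congr 1
    ring

/-- The Weierstrass three-term relation. -/
lemma oddTheta_weierstrass {τ : ℂ} (hτ : 0 < τ.im) (x y z t : ℂ) :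
    oddTheta (x + y) τ * oddTheta (x - y) τ * (oddTheta (z + t) τ * oddTheta (z - t) τ)
      - oddTheta (x + z) τ * oddTheta (x - z) τ * (oddTheta (y + t) τ * oddTheta (y - t) τ)
      + oddTheta (x + t) τ * oddTheta (x - t) τ * (oddTheta (y + z) τ * oddTheta (y - z) τ)
      = 0 := by
  obtain ⟨A, B, h⟩ := exists_oddTheta_add_mul_sub hτ
  simp only [h]
  ring

lemma oddTheta_sq_mul_fifth {τ : ℂ} (hτ : 0 < τ.im) (a : ℂ) :
    oddTheta a τ ^ 2 * (oddTheta (1 / 5) τ * oddTheta (2 / 5) τ)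
      = oddTheta (a + 1 / 5) τ * oddTheta (a - 1 / 5) τ * oddTheta (2 / 5) τ ^ 2
        - oddTheta (a + 2 / 5) τ * oddTheta (a - 2 / 5) τ * oddTheta (1 / 5) τ ^ 2 := by
  have h := oddTheta_weierstrass hτ a 0 (1 / 5) (2 / 5)
  have h3 : oddTheta (1 / 5 + 2 / 5) τ = oddTheta (2 / 5) τ := by
    rw [show (1 / 5 + 2 / 5 : ℂ) = -(2 / 5) + 1 by norm_num, oddTheta_add_one, oddTheta_neg,
      neg_neg]
  have h1 : oddTheta (1 / 5 - 2 / 5) τ = -oddTheta (1 / 5) τ := by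
    rw [← oddTheta_neg]
    norm_num
  rw [h3, h1] at h
  simp only [add_zero, sub_zero, zero_add, zero_sub, oddTheta_neg] at h
  linear_combination -h

lemma oddTheta_fifth_identity {τ : ℂ} (hτ : 0 < τ.im) (a : ℂ) :
    oddTheta (2 / 5) τ * (oddTheta (a + 1 / 5) τ ^ 2 * oddTheta (a - 2 / 5) τ
        - oddTheta (a - 1 / 5) τ ^ 2 * oddTheta (a + 2 / 5) τ)
      = oddTheta (1 / 5) τ * (oddTheta (a - 2 / 5) τ ^ 2 * oddTheta (a - 1 / 5) τ
        - oddTheta (a + 2 / 5) τ ^ 2 * oddTheta (a + 1 / 5) τ) := by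
  have r1 := oddTheta_sq_mul_fifth hτ (a + 1 / 5)
  have r2 := oddTheta_sq_mul_fifth hτ (a - 1 / 5)
  have r3 := oddTheta_sq_mul_fifth hτ (a + 2 / 5)
  have r4 := oddTheta_sq_mul_fifth hτ (a - 2 / 5)
  have e3 : oddTheta (a + 3 / 5) τ = -oddTheta (a - 2 / 5) τ := by
    rw [← oddTheta_add_one]
    ring_nf
  have e4 : oddTheta (a - 3 / 5) τ = -oddTheta (a + 2 / 5) τ := by
    rw [eq_neg_iff_add_eq_zero, show a + 2 / 5 = a - 3 / 5 + 1 by ring, oddTheta_add_one,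
      add_neg_cancel]
  rw [show a + 1 / 5 + 1 / 5 = a + 2 / 5 by ring, show a + 1 / 5 - 1 / 5 = a by ring,
    show a + 1 / 5 + 2 / 5 = a + 3 / 5 by ring, show a + 1 / 5 - 2 / 5 = a - 1 / 5 by ring,
    e3] at r1
  rw [show a - 1 / 5 + 1 / 5 = a by ring, show a - 1 / 5 - 1 / 5 = a - 2 / 5 by ring,
    show a - 1 / 5 + 2 / 5 = a + 1 / 5 by ring, show a - 1 / 5 - 2 / 5 = a - 3 / 5 by ring,
    e4] at r2
  rw [show a + 2 / 5 + 1 / 5 = a + 3 / 5 by ring, show a + 2 / 5 - 1 / 5 = a + 1 / 5 by ring,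
    e3] at r3
  rw [show a - 2 / 5 + 1 / 5 = a - 1 / 5 by ring, show a - 2 / 5 - 1 / 5 = a - 3 / 5 by ring,
    e4] at r4
  by_cases h1 : oddTheta (1 / 5) τ = 0
  · by_cases h2 : oddTheta (2 / 5) τ = 0
    · rw [h1, h2]
      ring
    · rw [h1] at r3 r4 ⊢
      have q3 : oddTheta (a + 1 / 5) τ * oddTheta (a - 2 / 5) τ = 0 := by
        refine (mul_eq_zero.mp ?_).resolve_right (pow_ne_zero 2 h2)
        linear_combination r3
      have q4 : oddTheta (a - 1 / 5) τ * oddTheta (a + 2 / 5) τ = 0 := by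
        refine (mul_eq_zero.mp ?_).resolve_right (pow_ne_zero 2 h2)
        linear_combination r4
      linear_combination oddTheta (2 / 5) τ * oddTheta (a + 1 / 5) τ * q3
        - oddTheta (2 / 5) τ * oddTheta (a - 1 / 5) τ * q4
  · refine mul_left_cancel₀ h1 ?_
    linear_combination oddTheta (a - 2 / 5) τ * r1 - oddTheta (a + 2 / 5) τ * r2

lemma θ_eq_oddTheta (ε ε' : ℝ) (τ : ℂ) :
    θ ε ε' τ = exp (Real.pi * I * (((ε : ℂ) - 1) / 2) ^ 2 * τ
      + Real.pi * I * (((ε : ℂ) - 1) / 2) * ε')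
      * oddTheta (((ε : ℂ) - 1) / 2 * τ + ((ε' : ℂ) - 1) / 2) τ := by
  rw [θ, oddTheta, ← tsum_mul_left]
  refine tsum_congr fun n ↦ ?_
  rw [oddThetaTerm, ← exp_add]
  congr 1
  ring

lemma θ_one_eq_oddTheta (ε' : ℝ) (τ : ℂ) : θ 1 ε' τ = oddTheta (((ε' : ℂ) - 1) / 2) τ := by
  rw [θ_eq_oddTheta]
  simp

theorem rational_onefifth (τ : ℂ) (hτ : 0 < τ.im) :
    θ 1 (1/5) τ * (ζ₅ ^ 2 * θ (1/5) (7/5) τ ^ 2 * θ (1/5) (1/5) τ - ζ₅ ^ 2 * θ (1/5) (3/5) τ ^ 2 * θ (1/5) (9/5) τ) = θ 1 (3/5) τ * (θ (1/5) (1/5) τ ^ 2 * θ (1/5) (3/5) τ - ζ₅ ^ 4 * θ (1/5) (9/5) τ ^ 2 * θ (1/5) (7/5) τ) := by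
  have h := oddTheta_fifth_identity hτ (-(2 / 5) * τ)
  have t1 : θ 1 (1 / 5) τ = -oddTheta (2 / 5) τ := by
    rw [θ_one_eq_oddTheta, ← oddTheta_neg]
    push_cast
    norm_num
  have t3 : θ 1 (3 / 5) τ = -oddTheta (1 / 5) τ := by
    rw [θ_one_eq_oddTheta, ← oddTheta_neg]
    push_cast
    norm_num
  set g : ℂ := exp (-(2 * Real.pi * I / 25)) with hg
  set C : ℂ := exp (4 * Real.pi * I / 25 * τ) with hC
  have fifth (m : ℕ) (ε' : ℝ) (w : ℂ) (hm : ε' = m / 5) (hw : w = (m - 5) / 10) :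
      θ (1 / 5) ε' τ = C * g ^ m * oddTheta (-(2 / 5) * τ + w) τ := by
    rw [θ_eq_oddTheta, hg, hC, ← exp_nat_mul, ← exp_add, hm, hw]
    push_cast
    congr 2 <;> ring
  have f1 := fifth 1 (1 / 5) (-(2 / 5)) (by norm_num) (by norm_num)
  have f3 := fifth 3 (3 / 5) (-(1 / 5)) (by norm_num) (by norm_num)
  have f7 := fifth 7 (7 / 5) (1 / 5) (by norm_num) (by norm_num)
  have f9 := fifth 9 (9 / 5) (2 / 5) (by norm_num) (by norm_num)
  rw [← sub_eq_add_neg] at f1 f3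
  have hζ : ζ₅ * g ^ 5 = 1 := by
    rw [ζ₅, hg, ← exp_nat_mul, ← exp_add, ← exp_zero]
    push_cast
    congr 1
    ring
  rw [t1, t3, f1, f3, f7, f9]
  generalize oddTheta (-(2 / 5) * τ - 2 / 5) τ = x1 at *
  generalize oddTheta (-(2 / 5) * τ - 1 / 5) τ = x3 at *
  generalize oddTheta (-(2 / 5) * τ + 1 / 5) τ = x7 at *
  generalize oddTheta (-(2 / 5) * τ + 2 / 5) τ = x9 at *
  have c1 : ζ₅ ^ 2 * g ^ 15 = g ^ 5 := by
    linear_combination (g ^ 5 * (ζ₅ * g ^ 5 + 1)) * hζ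
  have c2 : ζ₅ ^ 4 * g ^ 25 = g ^ 5 := by
    linear_combination (g ^ 5 * (ζ₅ ^ 2 * g ^ 10 + 1) * (ζ₅ * g ^ 5 + 1)) * hζ
  generalize oddTheta (2 / 5) τ = s2 at *
  generalize oddTheta (1 / 5) τ = s1 at *
  linear_combination (-C ^ 3 * g ^ 5) * h - C ^ 3 * s2 * (x7 ^ 2 * x1 - x3 ^ 2 * x9) * c1
    - C ^ 3 * s1 * x9 ^ 2 * x7 * c2
end

section
/- For every τ in the complex upper half-plane, θ[1,1/5](τ)·( ζ₅·θ[3/5,7/5](τ)²·θ[3/5,1/5](τ) − ζ₅·θ[3/5,3/5](τ)²·θ[3/5,9/5](τ) ) = θ[1,3/5](τ)·( θ[3/5,1/5](τ)²·θ[3/5,3/5](τ) − ζ₅²·θ[3/5,9/5](τ)²·θ[3/5,7/5](τ) ). -/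
open Complex

/-- The theta function `∑_{n ∈ ℤ} exp(πi(n+c)²τ + 2πi(n+c)z)`, as a multiple of a translate of
`jacobiTheta₂`. -/
noncomputable def thetaChar (c z τ : ℂ) : ℂ :=
  cexp (Real.pi * I * c ^ 2 * τ + 2 * Real.pi * I * c * z) * jacobiTheta₂ (z + c * τ) τ

lemma hasSum_thetaChar (c z : ℂ) {τ : ℂ} (hτ : 0 < τ.im) :
    HasSum (fun n : ℤ ↦ cexp (Real.pi * I * (n + c) ^ 2 * τ + 2 * Real.pi * I * (n + c) * z))
      (thetaChar c z τ) := by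
  refine ((hasSum_jacobiTheta₂_term (z + c * τ) hτ).mul_left _).congr_fun fun n ↦ ?_
  rw [jacobiTheta₂_term, ← Complex.exp_add]
  ring_nf

lemma θ_eq_thetaChar (ε ε' : ℝ) {τ : ℂ} (hτ : 0 < τ.im) :
    θ ε ε' τ = thetaChar (ε / 2) (ε' / 2) τ := by
  rw [θ, ← (hasSum_thetaChar _ _ hτ).tsum_eq]
  refine tsum_congr fun n ↦ ?_
  ring_nf

lemma thetaChar_sub_mul (c d z τ : ℂ) :
    thetaChar c (z - d * τ) τ =
      cexp (-(Real.pi * I * d ^ 2 * τ) + 2 * Real.pi * I * d * z) * thetaChar (c - d) z τ := by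
  rw [thetaChar, thetaChar, ← mul_assoc, ← Complex.exp_add]
  ring_nf

lemma thetaChar_half_add_one (z τ : ℂ) :
    thetaChar (1 / 2) (z + 1) τ = -thetaChar (1 / 2) z τ := by
  rw [thetaChar, thetaChar, add_right_comm z 1, jacobiTheta₂_add_left, ← neg_mul,
    ← neg_one_mul (cexp _), ← Complex.exp_pi_mul_I, ← Complex.exp_add]
  ring_nf

lemma thetaChar_half_neg (z τ : ℂ) : thetaChar (1 / 2) (-z) τ = thetaChar (1 / 2) z τ := by
  have h : jacobiTheta₂ (z + 1 / 2 * τ) τ =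
      cexp (-(2 * Real.pi * I * z)) * jacobiTheta₂ (-z + 1 / 2 * τ) τ := by
    rw [show z + 1 / 2 * τ = (z - 1 / 2 * τ) + τ by ring, jacobiTheta₂_add_left',
      show -z + 1 / 2 * τ = -(z - 1 / 2 * τ) by ring, jacobiTheta₂_neg_left]
    ring_nf
  rw [thetaChar, thetaChar, h, ← mul_assoc, ← Complex.exp_add]
  ring_nf

/-- A sum over pairs of integers, split according to the parity of the sum of the two entries. -/
lemma hasSum_int_prod_of_parity {f : ℤ × ℤ → ℂ} {a b : ℂ}
    (ho : HasSum (fun p : ℤ × ℤ ↦ f (p.1 + p.2, p.1 - p.2 - 1)) a)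
    (he : HasSum (fun p : ℤ × ℤ ↦ f (p.1 + p.2, p.1 - p.2)) b) : HasSum f (a + b) := by
  have hi : Function.Injective fun p : ℤ × ℤ ↦ (p.1 + p.2, p.1 - p.2 - 1) := by
    rintro ⟨a, b⟩ ⟨c, d⟩ h
    simp only [Prod.mk.injEq] at h ⊢
    omega
  have hj : Function.Injective fun p : ℤ × ℤ ↦ (p.1 + p.2, p.1 - p.2) := by
    rintro ⟨a, b⟩ ⟨c, d⟩ h
    simp only [Prod.mk.injEq] at h ⊢
    omega
  refine HasSum.add_isCompl ⟨Set.disjoint_left.2 ?_, codisjoint_iff_le_sup.2 ?_⟩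
    (hi.hasSum_range_iff.2 ho) (hj.hasSum_range_iff.2 he)
  · rintro _ ⟨p, rfl⟩ ⟨q, hq⟩
    simp only [Prod.mk.injEq] at hq
    omega
  · rintro ⟨m, n⟩ -
    rcases Int.even_or_odd' (m + n) with ⟨k, hk | hk⟩
    · exact Or.inr ⟨(k, m - k), by simp only [Prod.mk.injEq]; omega⟩
    · exact Or.inl ⟨(k + 1, m - k - 1), by simp only [Prod.mk.injEq]; omega⟩

lemma hasSum_int_prod_mul {f g : ℤ → ℂ} {a b : ℂ} (hf : HasSum f a) (hg : HasSum g b) :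
    HasSum (fun p : ℤ × ℤ ↦ f p.1 * g p.2) (a * b) :=
  hf.mul hg (summable_mul_of_summable_norm hf.summable.norm hg.summable.norm)

lemma hasSum_thetaChar_mul (c d z w : ℂ) {τ : ℂ} (hτ : 0 < τ.im) :
    HasSum (fun p : ℤ × ℤ ↦ cexp (Real.pi * I * ((p.1 + c) ^ 2 + (p.2 + d) ^ 2) * τ +
      2 * Real.pi * I * ((p.1 + c) * z + (p.2 + d) * w)))
      (thetaChar c z τ * thetaChar d w τ) := by
  refine (hasSum_int_prod_mul (hasSum_thetaChar c z hτ) (hasSum_thetaChar d w hτ)).congr_fun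
    fun p ↦ ?_
  rw [← Complex.exp_add]
  ring_nf

/-- Schröter's product formula, separating the two variables of `θ(x+y)θ(x-y)`. -/
lemma thetaChar_half_mul (x y : ℂ) {τ : ℂ} (hτ : 0 < τ.im) :
    thetaChar (1 / 2) (x + y) τ * thetaChar (1 / 2) (x - y) τ =
      thetaChar 0 (2 * x) (2 * τ) * thetaChar (1 / 2) (2 * y) (2 * τ) +
        thetaChar (1 / 2) (2 * x) (2 * τ) * thetaChar 0 (2 * y) (2 * τ) := by
  have hτ' : 0 < (2 * τ).im := by simpa using hτ
  refine (hasSum_thetaChar_mul _ _ _ _ hτ).unique (hasSum_int_prod_of_parity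
    ((hasSum_thetaChar_mul _ _ _ _ hτ').congr_fun fun p ↦ ?_)
    ((hasSum_thetaChar_mul _ _ _ _ hτ').congr_fun fun p ↦ ?_))
  · push_cast
    ring_nf
  · push_cast
    ring_nf

lemma thetaChar_half_mul_shift (x y : ℂ) {τ : ℂ} (hτ : 0 < τ.im) :
    thetaChar (1 / 2) (x + y + 1 / 2) τ * thetaChar (1 / 2) (x - y + 1 / 2) τ =
      thetaChar 0 (2 * x) (2 * τ) * thetaChar (1 / 2) (2 * y) (2 * τ) -
        thetaChar (1 / 2) (2 * x) (2 * τ) * thetaChar 0 (2 * y) (2 * τ) := by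
  have h := thetaChar_half_mul (x + 1 / 2) y hτ
  have h₀ : thetaChar 0 (2 * x + 1) (2 * τ) = thetaChar 0 (2 * x) (2 * τ) := by
    simp [thetaChar, jacobiTheta₂_add_left]
  rw [show 2 * (x + 1 / 2) = 2 * x + 1 by ring, thetaChar_half_add_one, h₀,
    show x + 1 / 2 + y = x + y + 1 / 2 by ring, show x + 1 / 2 - y = x - y + 1 / 2 by ring] at h
  rw [h]
  ring

/-- A three-term relation for the odd theta function `z ↦ thetaChar (1 / 2) (z + 1 / 2) τ`. -/
lemma thetaChar_three_term (v a : ℂ) {τ : ℂ} (hτ : 0 < τ.im) {s : ℂ → ℂ}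
    (hs : ∀ z, s z = thetaChar (1 / 2) (z + 1 / 2) τ) :
    s v * (s (v - a) ^ 2 * s (v + 2 * a) - s (v + a) ^ 2 * s (v - 2 * a)) =
      s (2 * v) * s (2 * a) * s a ^ 2 := by
  have key (x y : ℂ) := thetaChar_half_mul_shift x y hτ
  simp only [← hs] at key
  have h₁ := key (v + a) a
  have h₂ := key (v - a) 0
  have h₃ := key (v - a) a
  have h₄ := key (v + a) 0
  have h₅ := key (v + a) (v - a)
  have h₆ := key a 0
  rw [show v + a + a = v + 2 * a by ring, show v + a - a = v by ring] at h₁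
  rw [show v - a + a = v by ring, show v - a - a = v - 2 * a by ring] at h₃
  rw [show v + a + (v - a) = 2 * v by ring, show v + a - (v - a) = 2 * a by ring] at h₅
  rw [add_zero, sub_zero] at h₂ h₄ h₆
  calc
    _ = s (v + 2 * a) * s v * (s (v - a) * s (v - a)) -
        s v * s (v - 2 * a) * (s (v + a) * s (v + a)) := by ring
    _ = s (2 * v) * s (2 * a) * (s a * s a) := by
      rw [h₁, h₂, h₃, h₄, h₅, h₆]
      ring
    _ = _ := by ring

lemma differentiable_thetaChar (c : ℂ) {τ : ℂ} (hτ : 0 < τ.im) :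
    Differentiable ℂ (fun z ↦ thetaChar c z τ) := by
  intro z
  have h := (differentiableAt_jacobiTheta₂_fst (z + c * τ) hτ).comp z
    (differentiableAt_id.add_const (c * τ))
  unfold thetaChar
  exact DifferentiableAt.mul (by fun_prop) h

lemma integral_jacobiTheta₂ {τ : ℂ} (hτ : 0 < τ.im) :
    ∫ x in (0 : ℝ)..1, jacobiTheta₂ x τ = 1 := by
  have h : HasSum (fun n : ℤ ↦ ∫ x in (0 : ℝ)..1, jacobiTheta₂_term n x τ)
      (∫ x in (0 : ℝ)..1, jacobiTheta₂ x τ) := by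
    refine intervalIntegral.hasSum_integral_of_dominated_convergence
      (fun n _ ↦ ‖jacobiTheta₂_term n 0 τ‖) (fun n ↦ ?_) (fun n ↦ ?_) ?_ ?_ ?_
    · unfold jacobiTheta₂_term
      exact Continuous.aestronglyMeasurable (by fun_prop)
    · exact .of_forall fun x _ ↦ by simp [norm_jacobiTheta₂_term]
    · exact .of_forall fun x _ ↦ ((summable_jacobiTheta₂_term_iff 0 τ).2 hτ).norm
    · exact intervalIntegrable_const
    · exact .of_forall fun x _ ↦ hasSum_jacobiTheta₂_term x hτ
  refine h.unique ?_
  convert hasSum_ite_eq (0 : ℤ) (1 : ℂ) using 2 with n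
  split_ifs with hn
  · simp [hn, jacobiTheta₂_term]
  · have hc : 2 * Real.pi * I * n ≠ 0 := by simp [hn, Real.pi_ne_zero]
    simp only [jacobiTheta₂_term, Complex.exp_add, intervalIntegral.integral_mul_const,
      integral_exp_mul_complex hc]
    have h1 : cexp (2 * Real.pi * I * n) = 1 := by
      rw [mul_comm, Complex.exp_int_mul_two_pi_mul_I]
    simp [h1]

lemma exists_thetaChar_ne_zero (c : ℂ) {τ : ℂ} (hτ : 0 < τ.im) : ∃ z, thetaChar c z τ ≠ 0 := by
  by_contra! h
  have h' (z : ℂ) : jacobiTheta₂ z τ = 0 := by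
    simpa [thetaChar, Complex.exp_ne_zero] using h (z - c * τ)
  simpa [h'] using integral_jacobiTheta₂ hτ

/-- The cubic theta relation attached to the `5`-torsion point `1/5`. -/
lemma thetaChar_cubic (u : ℂ) {τ : ℂ} (hτ : 0 < τ.im) {s : ℂ → ℂ}
    (hs : ∀ z, s z = thetaChar (1 / 2) (z + 1 / 2) τ) :
    s (2 / 5) * (s (u - 1 / 5) ^ 2 * s (u + 2 / 5) - s (u + 1 / 5) ^ 2 * s (u - 2 / 5)) =
      s (1 / 5) * (s (u + 2 / 5) ^ 2 * s (u + 1 / 5) - s (u - 2 / 5) ^ 2 * s (u - 1 / 5)) := by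
  have hs1 (z : ℂ) : s (z + 1) = -s z := by
    rw [hs, hs, add_right_comm, thetaChar_half_add_one]
  have hs0 (z : ℂ) : s (-z) = -s z := by
    have h := thetaChar_half_add_one (z - 1 / 2) τ
    rw [show z - 1 / 2 + 1 = z + 1 / 2 by ring] at h
    rw [hs, hs, h, neg_neg, ← thetaChar_half_neg]
    ring_nf
  have hd : Differentiable ℂ s := by
    rw [funext hs]
    exact (differentiable_thetaChar _ hτ).comp (by fun_prop : Differentiable ℂ fun z : ℂ ↦ z + 1 / 2)
  let D : ℂ → ℂ := fun v ↦
    s (2 / 5) * (s (v - 1 / 5) ^ 2 * s (v + 2 / 5) - s (v + 1 / 5) ^ 2 * s (v - 2 / 5)) -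
      s (1 / 5) * (s (v + 2 / 5) ^ 2 * s (v + 1 / 5) - s (v - 2 / 5) ^ 2 * s (v - 1 / 5))
  have hD : Differentiable ℂ D := by fun_prop
  have hmul (v : ℂ) : s v * D v = 0 := by
    have h₁ := thetaChar_three_term v (1 / 5) hτ hs
    have h₂ := thetaChar_three_term v (-(2 / 5)) hτ hs
    rw [show v + 2 * (1 / 5) = v + 2 / 5 by ring, show v - 2 * (1 / 5) = v - 2 / 5 by ring,
      show (2 * (1 / 5) : ℂ) = 2 / 5 by ring] at h₁
    have e₁ : s (v + 2 * -(2 / 5)) = -s (v + 1 / 5) := by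
      rw [← neg_eq_iff_eq_neg, ← hs1]
      ring_nf
    have e₂ : s (v - 2 * -(2 / 5)) = -s (v - 1 / 5) := by
      rw [← hs1]
      ring_nf
    have e₃ : s (2 * -(2 / 5)) = -s (1 / 5) := by
      rw [← neg_eq_iff_eq_neg, ← hs1]
      ring_nf
    rw [e₁, e₂, e₃, hs0, sub_neg_eq_add, ← sub_eq_add_neg] at h₂
    linear_combination s (2 / 5) * h₁ + s (1 / 5) * h₂
  rcases (hd.differentiableOn.analyticOnNhd isOpen_univ).eq_zero_or_eq_zero_of_mul_eq_zero
    (hD.differentiableOn.analyticOnNhd isOpen_univ) (fun v _ ↦ hmul v) isPreconnected_univ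
    with h | h
  · obtain ⟨z, hz⟩ := exists_thetaChar_ne_zero (1 / 2) hτ
    refine absurd ?_ hz
    simpa [hs] using h (z - 1 / 2) trivial
  · exact sub_eq_zero.1 (h u trivial)

lemma θ_three_fifths_eq (ε' : ℝ) {τ : ℂ} (hτ : 0 < τ.im) :
    θ (3 / 5) ε' τ = cexp (Real.pi * I * τ / 25 - Real.pi * I * ε' / 5) *
      thetaChar (1 / 2) (ε' / 2 - τ / 5) τ := by
  rw [θ_eq_thetaChar _ _ hτ, show τ / 5 = 1 / 5 * τ by ring, thetaChar_sub_mul, ← mul_assoc,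
    ← Complex.exp_add]
  push_cast
  ring_nf
  simp

theorem rational_threefifths (τ : ℂ) (hτ : 0 < τ.im) :
    θ 1 (1/5) τ * (ζ₅ * θ (3/5) (7/5) τ ^ 2 * θ (3/5) (1/5) τ - ζ₅ * θ (3/5) (3/5) τ ^ 2 * θ (3/5) (9/5) τ) = θ 1 (3/5) τ * (θ (3/5) (1/5) τ ^ 2 * θ (3/5) (3/5) τ - ζ₅ ^ 2 * θ (3/5) (9/5) τ ^ 2 * θ (3/5) (7/5) τ) := by
  have key := thetaChar_cubic (-(τ / 5)) hτ fun _ ↦ rfl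
  have hneg (z w : ℂ) (h : z + w = 1) : thetaChar (1 / 2) z τ = -thetaChar (1 / 2) w τ := by
    rw [← thetaChar_half_neg w, ← thetaChar_half_add_one, ← h]
    ring_nf
  rw [hneg (2 / 5 + 1 / 2) (1 / 10) (by norm_num), hneg (1 / 5 + 1 / 2) (3 / 10) (by norm_num),
    show -(τ / 5) - 1 / 5 + 1 / 2 = 3 / 10 - τ / 5 by ring,
    show -(τ / 5) + 1 / 5 + 1 / 2 = 7 / 10 - τ / 5 by ring,
    show -(τ / 5) - 2 / 5 + 1 / 2 = 1 / 10 - τ / 5 by ring,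
    show -(τ / 5) + 2 / 5 + 1 / 2 = 9 / 10 - τ / 5 by ring] at key
  have hexp (k : ℕ) : cexp (Real.pi * I * τ / 25 - Real.pi * I * (k / 5) / 5) =
      cexp (Real.pi * I * τ / 25) * cexp (-(Real.pi * I / 25)) ^ k := by
    rw [← Complex.exp_nat_mul, ← Complex.exp_add]
    ring_nf
  have hζ : ζ₅ * cexp (-(Real.pi * I / 25)) ^ 10 = 1 := by
    rw [ζ₅, ← Complex.exp_nat_mul, ← Complex.exp_add, Complex.exp_eq_one_iff]
    exact ⟨0, by push_cast; ring⟩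
  have h1 := hexp 1
  have h3 := hexp 3
  have h7 := hexp 7
  have h9 := hexp 9
  push_cast at h1 h3 h7 h9
  simp only [θ_three_fifths_eq _ hτ, θ_eq_thetaChar 1 _ hτ]
  push_cast
  rw [h1, h3, h7, h9, show (7 / 5 / 2 : ℂ) = 7 / 10 by norm_num,
    show (1 / 5 / 2 : ℂ) = 1 / 10 by norm_num, show (3 / 5 / 2 : ℂ) = 3 / 10 by norm_num,
    show (9 / 5 / 2 : ℂ) = 9 / 10 by norm_num]
  generalize cexp (Real.pi * I * τ / 25) = q
  generalize cexp (-(Real.pi * I / 25)) = w at hζ ⊢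
  generalize thetaChar (1 / 2) (1 / 10) τ = S₁ at key ⊢
  generalize thetaChar (1 / 2) (3 / 10) τ = S₃ at key ⊢
  generalize thetaChar (1 / 2) (1 / 10 - τ / 5) τ = B₁ at key ⊢
  generalize thetaChar (1 / 2) (3 / 10 - τ / 5) τ = B₃ at key ⊢
  generalize thetaChar (1 / 2) (7 / 10 - τ / 5) τ = B₇ at key ⊢
  generalize thetaChar (1 / 2) (9 / 10 - τ / 5) τ = B₉ at key ⊢
  linear_combination q ^ 3 * w ^ 5 * key +
    q ^ 3 * w ^ 5 * (S₁ * (B₇ ^ 2 * B₁ - B₃ ^ 2 * B₉) +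
      S₃ * (ζ₅ * w ^ 10 + 1) * (B₉ ^ 2 * B₇)) * hζ
end

section
/- For every τ in the complex upper half-plane, θ[1,1/5](τ)·θ[3/5,3/5](τ)³ = ζ₅·( ζ₅·θ[1/5,9/5](τ)³·θ[3/5,1](τ) + θ[1/5,3/5](τ)³·θ[3/5,1/5](τ) ). -/
open Complex

/-- The `n`-th summand of `θ ε ε' τ`. -/
noncomputable def thetaTerm (ε ε' : ℝ) (τ : ℂ) (n : ℤ) : ℂ :=
  Complex.exp (2 * Real.pi * Complex.I *
    ((1 / 2) * ((n : ℂ) + (ε : ℂ) / 2) ^ 2 * τ + ((n : ℂ) + (ε : ℂ) / 2) * ((ε' : ℂ) / 2)))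

/-- The phase `exp(πix)`. -/
noncomputable def phase (x : ℝ) : ℂ := Complex.exp (Real.pi * Complex.I * x)

lemma phase_add (x y : ℝ) : phase (x + y) = phase x * phase y := by
  simp only [phase, ← Complex.exp_add]
  push_cast
  ring_nf

lemma theta_eq_tsum (ε ε' : ℝ) (τ : ℂ) : θ ε ε' τ = ∑' n, thetaTerm ε ε' τ n := rfl

lemma summable_thetaTerm (ε ε' : ℝ) {τ : ℂ} (hτ : 0 < τ.im) :
    Summable (thetaTerm ε ε' τ) := by
  have h := ((summable_jacobiTheta₂_term_iff ((ε * τ + ε') / 2) τ).2 hτ).mul_left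
    (Complex.exp (Real.pi * Complex.I * (ε ^ 2 * τ / 4 + ε * ε' / 2)))
  refine h.congr fun n => ?_
  rw [jacobiTheta₂_term, thetaTerm, ← Complex.exp_add]
  congr 1
  ring

lemma theta_add_two_left (ε ε' : ℝ) (τ : ℂ) : θ (ε + 2) ε' τ = θ ε ε' τ := by
  rw [theta_eq_tsum, theta_eq_tsum, ← (Equiv.addRight (1 : ℤ)).tsum_eq (thetaTerm ε ε' τ)]
  refine tsum_congr fun n => ?_
  simp only [thetaTerm, Equiv.coe_addRight]
  push_cast
  congr 1
  ring

lemma theta_add_two_right (ε ε' : ℝ) (τ : ℂ) : θ ε (ε' + 2) τ = phase ε * θ ε ε' τ := by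
  rw [theta_eq_tsum, theta_eq_tsum, ← tsum_mul_left]
  refine tsum_congr fun n => ?_
  rw [thetaTerm, thetaTerm, phase, ← Complex.exp_add, Complex.exp_eq_exp_iff_exists_int]
  refine ⟨n, ?_⟩
  push_cast
  ring

lemma theta_neg_neg (ε ε' : ℝ) (τ : ℂ) : θ (-ε) (-ε') τ = θ ε ε' τ := by
  rw [theta_eq_tsum, theta_eq_tsum, ← (Equiv.neg ℤ).tsum_eq (thetaTerm ε ε' τ)]
  refine tsum_congr fun n => ?_
  simp only [thetaTerm, Equiv.neg_apply]
  push_cast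
  congr 1
  ring

/-- The bijection `ℤ² ⊔ ℤ² → ℤ²` splitting pairs `(k, l)` by the parity of `k - l`. -/
def paritySplit : (ℤ × ℤ) ⊕ (ℤ × ℤ) → ℤ × ℤ :=
  Sum.elim (fun z => (z.1 + z.2, z.1 - z.2 - 1)) (fun z => (z.1 + z.2, z.1 - z.2))

lemma paritySplit_bijective : Function.Bijective paritySplit := by
  constructor
  · rintro (⟨a, b⟩ | ⟨a, b⟩) (⟨c, d⟩ | ⟨c, d⟩) h <;>
      simp only [paritySplit, Sum.elim_inl, Sum.elim_inr, Prod.mk.injEq, Sum.inl.injEq,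
        Sum.inr.injEq, reduceCtorEq] at h ⊢ <;> omega
  · rintro ⟨k, l⟩
    rcases Int.even_or_odd (k - l) with ⟨v, hv⟩ | ⟨v, hv⟩
    · refine ⟨Sum.inr (k - v, v), ?_⟩
      simp only [paritySplit, Sum.elim_inr, Prod.mk.injEq]
      omega
    · refine ⟨Sum.inl (k - v, v), ?_⟩
      simp only [paritySplit, Sum.elim_inl, Prod.mk.injEq]
      omega

/-- The addition formula expressing a product of two theta constants at `τ` through theta
constants at `2τ`. -/
lemma theta_mul_theta (p p' q q' : ℝ) {τ : ℂ} (hτ : 0 < τ.im) :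
    θ (1 + p + q) (1 + p' + q') τ * θ (1 + p - q) (1 + p' - q') τ =
      phase p * (θ p (2 * p') (2 * τ) * θ (q + 1) (2 * q') (2 * τ) -
        θ (p + 1) (2 * p') (2 * τ) * θ q (2 * q') (2 * τ)) := by
  have hτ2 : 0 < (2 * τ).im := by simpa using hτ
  have hs := fun ε ε' : ℝ => (summable_thetaTerm ε ε' hτ).norm
  have hs2 := fun ε ε' : ℝ => (summable_thetaTerm ε ε' hτ2).norm
  have hinl : ∀ z : ℤ × ℤ,
      thetaTerm (1 + p + q) (1 + p' + q') τ (z.1 + z.2) *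
        thetaTerm (1 + p - q) (1 + p' - q') τ (z.1 - z.2 - 1) =
      phase p * (thetaTerm p (2 * p') (2 * τ) z.1 * thetaTerm (q + 1) (2 * q') (2 * τ) z.2) := by
    rintro ⟨u, v⟩
    simp only [thetaTerm, phase, ← Complex.exp_add]
    rw [Complex.exp_eq_exp_iff_exists_int]
    refine ⟨u, ?_⟩
    push_cast
    ring
  have hinr : ∀ z : ℤ × ℤ,
      thetaTerm (1 + p + q) (1 + p' + q') τ (z.1 + z.2) *
        thetaTerm (1 + p - q) (1 + p' - q') τ (z.1 - z.2) =
      -phase p * (thetaTerm (p + 1) (2 * p') (2 * τ) z.1 * thetaTerm q (2 * q') (2 * τ) z.2) := by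
    rintro ⟨u, v⟩
    have hneg : -phase p = Complex.exp (Real.pi * Complex.I * p + Real.pi * Complex.I) := by
      rw [Complex.exp_add, Complex.exp_pi_mul_I, phase]
      ring
    rw [hneg]
    simp only [thetaTerm, ← Complex.exp_add]
    rw [Complex.exp_eq_exp_iff_exists_int]
    refine ⟨u, ?_⟩
    push_cast
    ring
  have hsum1 := (summable_mul_of_summable_norm (hs2 p (2 * p')) (hs2 (q + 1) (2 * q'))).mul_left
    (phase p)
  have hsum2 := (summable_mul_of_summable_norm (hs2 (p + 1) (2 * p')) (hs2 q (2 * q'))).mul_left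
    (-phase p)
  simp only [theta_eq_tsum]
  rw [tsum_mul_tsum_of_summable_norm (hs _ _) (hs _ _),
    tsum_mul_tsum_of_summable_norm (hs2 _ _) (hs2 _ _),
    tsum_mul_tsum_of_summable_norm (hs2 _ _) (hs2 _ _),
    ← (Equiv.ofBijective _ paritySplit_bijective).tsum_eq, Summable.tsum_sum]
  · simp only [Equiv.ofBijective_apply, paritySplit, Sum.elim_inl, Sum.elim_inr, hinl, hinr,
      tsum_mul_left]
    ring
  · exact hsum1.congr fun z => (hinl z).symm
  · exact hsum2.congr fun z => (hinr z).symm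

/-- A three-term relation between theta constants: the Plücker relation for the `2 × 2` minors
provided by `theta_mul_theta`. -/
lemma theta_three_term (a a' b b' c c' : ℝ) {τ : ℂ} (hτ : 0 < τ.im) :
    phase b * (θ (1 + a + b) (1 + a' + b') τ * θ (1 + a - b) (1 + a' - b') τ) *
        θ (1 + c) (1 + c') τ ^ 2 +
      phase c * (θ (1 + b + c) (1 + b' + c') τ * θ (1 + b - c) (1 + b' - c') τ) *
        θ (1 + a) (1 + a') τ ^ 2 +
      phase a * (θ (1 + c + a) (1 + c' + a') τ * θ (1 + c - a) (1 + c' - a') τ) *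
        θ (1 + b) (1 + b') τ ^ 2 = 0 := by
  have h0 := fun p p' : ℝ => theta_mul_theta p p' 0 0 hτ
  simp only [add_zero, sub_zero, ← pow_two] at h0
  rw [theta_mul_theta _ _ _ _ hτ, theta_mul_theta _ _ _ _ hτ, theta_mul_theta _ _ _ _ hτ,
    h0, h0, h0]
  ring

theorem rational_expr_two_onefifth (τ : ℂ) (hτ : 0 < τ.im) :
    θ 1 (1/5) τ * θ (3/5) (3/5) τ ^ 3 = ζ₅ * (ζ₅ * θ (1/5) (9/5) τ ^ 3 * θ (3/5) 1 τ + θ (1/5) (3/5) τ ^ 3 * θ (3/5) (1/5) τ) := by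
  have key := theta_three_term (4/5) (2/5) (-4/5) (-6/5) (-2/5) (-2/5) hτ
  have hB : θ (13/5) (13/5) τ = phase (3/5) * θ (3/5) (3/5) τ := by
    rw [← theta_add_two_right, ← theta_add_two_left (3/5)]; norm_num
  have hE : θ (1/5) (3/5) τ = phase (1/5) * θ (9/5) (7/5) τ := by
    rw [← theta_neg_neg (9/5), ← theta_add_two_left (-(9/5))]
    norm_num [← theta_add_two_right]
  have hE' : θ (-(1/5)) (-(3/5)) τ = θ (1/5) (3/5) τ := by
    rw [← theta_neg_neg (1/5)]
  have hC : θ (1/5) (9/5) τ = phase (1/5) * θ (1/5) (-(1/5)) τ := by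
    rw [← theta_add_two_right]; norm_num
  have hC' : θ (-(1/5)) (1/5) τ = θ (1/5) (-(1/5)) τ := by
    rw [← theta_neg_neg (1/5)]; norm_num
  have hD : θ (3/5) 1 τ = phase (3/5) * θ (7/5) 1 τ := by
    rw [← theta_neg_neg (7/5), ← theta_add_two_left (-(7/5))]
    norm_num [← theta_add_two_right]
  have hw : phase (1/5) ^ 5 = -1 := by
    rw [phase, ← Complex.exp_nat_mul, ← Complex.exp_pi_mul_I]
    push_cast
    ring_nf
  have hζ : ζ₅ = phase (1/5) ^ 2 := by
    rw [phase, ζ₅, ← Complex.exp_nat_mul]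
    push_cast
    ring_nf
  have h3 : phase (3/5) = phase (1/5) ^ 3 := by
    rw [pow_succ, pow_two, ← phase_add, ← phase_add]; norm_num
  have h4 : phase (4/5) = phase (1/5) ^ 4 := by
    rw [pow_succ, ← h3, ← phase_add]; norm_num
  have hneg (x : ℝ) : phase (x - 1) = -phase x := by
    have h1 : phase 1 = -1 := by simp [phase]
    have h2 := phase_add (x - 1) 1
    rw [sub_add_cancel, h1] at h2
    rw [h2]
    ring
  have hm4 : phase (-4/5) = -phase (1/5) := by rw [← hneg]; norm_num
  have hm2 : phase (-2/5) = -phase (1/5) ^ 3 := by rw [← h3, ← hneg]; norm_num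
  rw [hm4, hm2, h4] at key
  norm_num at key
  rw [hE', hC', hB, h3, hE] at key
  rw [hζ, hC, hD, h3, hE]
  linear_combination phase (1/5) * key +
    (θ 1 (1/5) τ * θ (3/5) (3/5) τ ^ 3 -
      phase (1/5) ^ 5 * θ (7/5) 1 τ * θ (1/5) (-(1/5)) τ ^ 3) * hw
end
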